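/- Fix R > 1 and let ℓ = {z ∈ ℍ : |z| = 1/R} and ℓ' = {z ∈ ℍ : |z| = R}. Define 𝒞₀ as the set of h ∈ PSL(2,ℝ) such that inf over x ∈ ℓ, x' ∈ ℓ' of d(x, h·x') − d(x, x') is strictly positive, h·ℓ' ⊆ {z ∈ ℍ : |z| > 1/R}, and ℓ ∩ h·({z ∈ ℍ : |z| > R}) = ∅. Set SQ(ℓ)⁻¹ = {h⁻¹ : h ∈ SQ(ℓ)}, ∂SQ(ℓ') = {P'_ε(t) : ε ∈ {1,−1}, t ≥ 0}, and ∂SQ(ℓ)⁻¹ = {P_ε(t)⁻¹ : ε ∈ {1,−1}, t ≥ 0}. Then the multiplication maps (q, p) ↦ q·p from SQ(ℓ)⁻¹ × ∂SQ(ℓ') to PSL(2,ℝ) and from ∂SQ(ℓ)⁻¹ × SQ(ℓ') to PSL(2,ℝ) are each injective with image exactly 𝒞₀, and each is a homeomorphism onto 𝒞₀ (all subsets carrying the topology induced from PSL(2,ℝ)). -/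

import Mathlib

noncomputable section

open Filter Topology Pointwise
open scoped UpperHalfPlane

/-- `SL(2,ℝ)`. -/
abbrev SL2 := Matrix.SpecialLinearGroup (Fin 2) ℝ

instance : TopologicalSpace SL2 :=
  TopologicalSpace.induced (fun A : SL2 => (A : Matrix (Fin 2) (Fin 2) ℝ)) inferInstance

/-- `PSL(2,ℝ) = SL(2,ℝ)/{±I}`. -/
abbrev PSL2 := SL2 ⧸ Subgroup.center SL2

/-- The Möbius action of an element of `PSL(2,ℝ)` on the upper half-plane,
computed via an (arbitrary) lift to `SL(2,ℝ)`; this is well defined since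
`-I` acts trivially. -/
def pslSMul (g : PSL2) (z : ℍ) : ℍ := (Quotient.out g) • z

/-- Image of a subset of `ℍ` under the Möbius action of `g ∈ PSL(2,ℝ)`. -/
def pslImg (g : PSL2) (s : Set ℍ) : Set ℍ := pslSMul g '' s

/-- A geodesic line of `ℍ`: the image of an isometric embedding of `ℝ` into `ℍ`. -/
def IsGeodesicLine (l : Set ℍ) : Prop := ∃ γ : ℝ → ℍ, Isometry γ ∧ Set.range γ = l

/-- The embedding of `ℍ` into the one-point compactification of `ℂ`. -/
def embH (z : ℍ) : OnePoint ℂ := ((z : ℂ) : OnePoint ℂ)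

/-- The embedding of `∂∞ℍ = ℝ ∪ {∞}` into the one-point compactification of `ℂ`. -/
def toC : OnePoint ℝ → OnePoint ℂ := OnePoint.map Complex.ofReal

/-- The vector `v(ξ) ∈ ℝ²` associated with a boundary point `ξ ∈ ℝ ∪ {∞}`:
`v(ξ) = (ξ, 1)` for `ξ ∈ ℝ` and `v(∞) = (1, 0)`. -/
def bvec (ξ : OnePoint ℝ) : Fin 2 → ℝ := Option.elim ξ ![1, 0] (fun r => ![r, 1])

/-- The extended Möbius action of `PSL(2,ℝ)` on `∂∞ℍ = ℝ ∪ {∞}`. -/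
def bdSMul (g : PSL2) (ξ : OnePoint ℝ) : OnePoint ℝ :=
  let w := ((Quotient.out g : SL2) : Matrix (Fin 2) (Fin 2) ℝ).mulVec (bvec ξ)
  if w 1 = 0 then OnePoint.infty else ((w 0 / w 1 : ℝ) : OnePoint ℝ)

/-- `ξ ∈ ℝ ∪ {∞}` is an endpoint of the geodesic line `l`: some isometric
parametrization of `l` tends to `ξ` (in the one-point compactification of `ℂ`). -/
def IsEndpoint (l : Set ℍ) (ξ : OnePoint ℝ) : Prop :=
  ∃ γ : ℝ → ℍ, Isometry γ ∧ Set.range γ = l ∧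
    Tendsto (fun t => embH (γ t)) atTop (𝓝 (toC ξ))

/-- `h ∈ PSL(2,ℝ)` has a nonattracting fixed point at `ξ ∈ ℝ ∪ {∞}`. -/
def HasNonattracting (h : PSL2) (ξ : OnePoint ℝ) : Prop :=
  ∃ A : SL2, (QuotientGroup.mk A : PSL2) = h ∧
    ∃ μ : ℝ, |μ| ≤ 1 ∧ (A : Matrix (Fin 2) (Fin 2) ℝ).mulVec (bvec ξ) = μ • bvec ξ

/-- `h ∈ PSL(2,ℝ)` has a nonrepelling fixed point at `ξ ∈ ℝ ∪ {∞}`. -/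
def HasNonrepelling (h : PSL2) (ξ : OnePoint ℝ) : Prop :=
  ∃ A : SL2, (QuotientGroup.mk A : PSL2) = h ∧
    ∃ μ : ℝ, 1 ≤ |μ| ∧ (A : Matrix (Fin 2) (Fin 2) ℝ).mulVec (bvec ξ) = μ • bvec ξ

/-- The right AdS crooked plane `C*(l)` centered at the identity. -/
def rightCrooked (l : Set ℍ) : Set PSL2 :=
  {h | (∃ x ∈ l, pslSMul h x = x) ∨ ∃ ξ, IsEndpoint l ξ ∧ HasNonattracting h ξ}

/-- The left AdS crooked plane `C(l)` centered at the identity. -/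
def leftCrooked (l : Set ℍ) : Set PSL2 :=
  {h | (∃ x ∈ l, pslSMul h x = x) ∨ ∃ ξ, IsEndpoint l ξ ∧ HasNonrepelling h ξ}

/-- A general right AdS crooked plane: a set of the form `g·C*(l)`. -/
def IsRightCrookedPlane (S : Set PSL2) : Prop :=
  ∃ (g : PSL2) (l : Set ℍ), IsGeodesicLine l ∧ S = (g * ·) '' rightCrooked l

/-- A general left AdS crooked plane: a set of the form `C(l)·g`. -/
def IsLeftCrookedPlane (S : Set PSL2) : Prop :=
  ∃ (g : PSL2) (l : Set ℍ), IsGeodesicLine l ∧ S = (· * g) '' leftCrooked l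

variable {Γ : Type*} [Group Γ]

/-- The action `γ·x = ρ(γ) x j(γ)⁻¹` of `Γ` on `PSL(2,ℝ)`, applied to a set. -/
def actImg (j ρ : Γ →* PSL2) (γ : Γ) (S : Set PSL2) : Set PSL2 :=
  (fun x => ρ γ * x * (j γ)⁻¹) '' S

/-- The action `γ·x = ρ(γ) x j(γ)⁻¹` is properly discontinuous. -/
def ProperlyDisc (j ρ : Γ →* PSL2) : Prop :=
  ∀ K : Set PSL2, IsCompact K → {γ : Γ | (actImg j ρ γ K ∩ K).Nonempty}.Finite

/-- `R` is a fundamental domain for the action `γ·x = ρ(γ) x j(γ)⁻¹`: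
`R` is closed, its translates cover `PSL(2,ℝ)`, and the interiors of the
translates are pairwise disjoint. -/
def IsFundDom (j ρ : Γ →* PSL2) (R : Set PSL2) : Prop :=
  IsClosed R ∧ (⋃ γ : Γ, actImg j ρ γ R) = Set.univ ∧
    Pairwise fun γ₁ γ₂ : Γ =>
      Disjoint (interior (actImg j ρ γ₁ R)) (interior (actImg j ρ γ₂ R))

/-- The action admits a fundamental domain bounded by pairwise disjoint
right AdS crooked planes. -/
def AdmitsRightCrookedFD (j ρ : Γ →* PSL2) : Prop :=
  ∃ (m : ℕ) (D : Fin m → Set PSL2), (∀ i, IsRightCrookedPlane (D i)) ∧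
    (∀ (γ γ' : Γ) (i i' : Fin m),
      actImg j ρ γ (D i) = actImg j ρ γ' (D i') ∨
      Disjoint (actImg j ρ γ (D i)) (actImg j ρ γ' (D i'))) ∧
    ∃ x ∈ (⋃ (γ : Γ) (i : Fin m), actImg j ρ γ (D i))ᶜ,
      IsFundDom j ρ
        (closure (connectedComponentIn (⋃ (γ : Γ) (i : Fin m), actImg j ρ γ (D i))ᶜ x))

/-- The action admits a fundamental domain bounded by pairwise disjoint
left AdS crooked planes. -/
def AdmitsLeftCrookedFD (j ρ : Γ →* PSL2) : Prop :=
  ∃ (m : ℕ) (D : Fin m → Set PSL2), (∀ i, IsLeftCrookedPlane (D i)) ∧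
    (∀ (γ γ' : Γ) (i i' : Fin m),
      actImg j ρ γ (D i) = actImg j ρ γ' (D i') ∨
      Disjoint (actImg j ρ γ (D i)) (actImg j ρ γ' (D i'))) ∧
    ∃ x ∈ (⋃ (γ : Γ) (i : Fin m), actImg j ρ γ (D i))ᶜ,
      IsFundDom j ρ
        (closure (connectedComponentIn (⋃ (γ : Γ) (i : Fin m), actImg j ρ γ (D i))ᶜ x))

/-- The translation length `λ(g) = inf_{p ∈ ℍ} d(p, g·p)`. -/
def transLength (g : PSL2) : ℝ := ⨅ p : ℍ, dist p (pslSMul g p)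

/-- `U` is a connected component of `S`. -/
def IsCC (S U : Set ℍ) : Prop := ∃ x ∈ S, connectedComponentIn S x = U

/-- `ξ ∈ ℝ ∪ {∞}` is an ideal point of `U ⊆ ℍ`: a limit of a sequence of points
of `U` in the one-point compactification of `ℂ`. -/
def IsIdealPoint (U : Set ℍ) (ξ : OnePoint ℝ) : Prop :=
  ∃ u : ℕ → ℍ, (∀ n, u n ∈ U) ∧ Tendsto (fun n => embH (u n)) atTop (𝓝 (toC ξ))

/-- The closed right crooked half-space `H̄*₊(l, U)`. -/
def closedRHS (l U : Set ℍ) : Set PSL2 :=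
  {h | (∃ x ∈ l ∪ U, pslSMul h x = x) ∨ ∃ ξ, IsIdealPoint U ξ ∧ HasNonattracting h ξ}

/-- The open right crooked half-space `H*₊(l, U)`. -/
def openRHS (l U : Set ℍ) : Set PSL2 :=
  {h | h ≠ 1 ∧ ((∃ x ∈ U, pslSMul h x = x) ∨
    ∃ ξ, IsIdealPoint U ξ ∧ ¬ IsEndpoint l ξ ∧ HasNonattracting h ξ)}

/-- The circle of (Euclidean) radius `c` in `ℍ` centered at `0`; for suitable `c`
this is a geodesic line of `ℍ`. -/
def circ (c : ℝ) : Set ℍ := {z : ℍ | ‖(z : ℂ)‖ = c}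

/-- The stem quadrant `SQ(ℓ)` for `ℓ = {|z| = 1/R}` transversely oriented towards `0`. -/
def SQell (R : ℝ) : Set PSL2 :=
  {h | ∃ (A : SL2) (α β v : ℝ), (QuotientGroup.mk A : PSL2) = h ∧
    (A : Matrix (Fin 2) (Fin 2) ℝ) = !![α, -v/R; v*R, β] ∧
    |α| < |β| ∧ 2*|v| < |α - β|}

/-- The inverse stem quadrant `SQ(ℓ')⁻¹` for `ℓ' = {|z| = R}` transversely
oriented towards `∞`. -/
def SQell'inv (R : ℝ) : Set PSL2 :=
  {h | ∃ (A : SL2) (α β v : ℝ), (QuotientGroup.mk A : PSL2) = h ∧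
    (A : Matrix (Fin 2) (Fin 2) ℝ) = !![α, v*R; -v/R, β] ∧
    |α| < |β| ∧ 2*|v| < |α - β|}

/-- The stem quadrant `SQ(ℓ')`. -/
def SQell' (R : ℝ) : Set PSL2 := {h | h⁻¹ ∈ SQell'inv R}


instance sl2TopGroup : IsTopologicalGroup SL2 :=
  @Matrix.SpecialLinearGroup.topologicalGroup (Fin 2) ℝ _ _ _ _ _

theorem mk_neg' (A : SL2) : (QuotientGroup.mk (-A) : PSL2) = QuotientGroup.mk A := by
  rw [QuotientGroup.eq]
  rw [Matrix.SpecialLinearGroup.mem_center_iff]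
  refine ⟨-1, by simp, ?_⟩
  have : (-A)⁻¹ * A = -1 := by
    rw [inv_mul_eq_iff_eq_mul]; simp
  rw [this]
  ext i j
  fin_cases i <;> fin_cases j <;> simp

theorem mk_eq_iff' (A B : SL2) :
    (QuotientGroup.mk A : PSL2) = QuotientGroup.mk B ↔ B = A ∨ B = -A := by
  constructor
  · intro h
    rw [QuotientGroup.eq, Matrix.SpecialLinearGroup.mem_center_iff] at h
    obtain ⟨r, hr, h⟩ := h
    have hr' : r = 1 ∨ r = -1 := by
      have : r ^ 2 = 1 := by simpa using hr
      simpa using this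
    rcases hr' with rfl | rfl
    · left
      have : A⁻¹ * B = 1 := by
        ext i j
        rw [← h]; simp
      rw [inv_mul_eq_iff_eq_mul] at this
      simpa using this
    · right
      have : A⁻¹ * B = -1 := by
        ext i j
        rw [← h]; fin_cases i <;> fin_cases j <;> simp
      rw [inv_mul_eq_iff_eq_mul] at this
      simpa using this
  · rintro (rfl | rfl)
    · rfl
    · rw [mk_neg']

theorem coe_smul' (A : SL2) (z : ℍ) : ((A • z : ℍ) : ℂ) =
    ((A 0 0 : ℂ) * z + A 0 1) / ((A 1 0 : ℂ) * z + A 1 1) := by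
  rw [UpperHalfPlane.coe_specialLinearGroup_apply]; simp

theorem pslSMul_mk (A : SL2) (z : ℍ) : pslSMul (QuotientGroup.mk A) z = A • z := by
  have h : (QuotientGroup.mk (Quotient.out (QuotientGroup.mk A : PSL2)) : PSL2)
      = QuotientGroup.mk A := QuotientGroup.out_eq' _
  rw [mk_eq_iff'] at h
  unfold pslSMul
  rcases h with h | h
  · rw [← h]
  · conv_rhs => rw [h]
    ext
    rw [coe_smul', coe_smul']
    simp only [Matrix.SpecialLinearGroup.coe_neg, Matrix.neg_apply, Complex.ofReal_neg]
    rw [← neg_div_neg_eq]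
    congr 1 <;> ring

theorem det2 (A : SL2) : A 0 0 * A 1 1 - A 0 1 * A 1 0 = 1 := by
  have := A.det_coe
  rwa [Matrix.det_fin_two] at this

theorem denom_ne (A : SL2) (z : ℍ) : ((A 1 0 : ℂ) * z + A 1 1) ≠ 0 := by
  intro h
  have him := congrArg Complex.im h
  have hre := congrArg Complex.re h
  simp at him hre
  have h1 : A 1 0 = 0 := by
    rcases him with h | h
    · exact h
    · exact absurd h z.im_pos.ne'
  have h2 : A 1 1 = 0 := by simpa [h1] using hre
  have := det2 A
  simp [h1, h2] at this

/-- the hyperbolic distance to a moved point, without denominators -/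
theorem cosh_smul (A : SL2) (z w : ℍ) :
    Real.cosh (dist z (A • w)) * (2 * z.im * w.im) = 2 * z.im * w.im +
      Complex.normSq ((z : ℂ) * ((A 1 0 : ℂ) * w + A 1 1) - ((A 0 0 : ℂ) * w + A 0 1)) := by
  have hd := denom_ne A w
  have him : (A • w).im = w.im / Complex.normSq ((A 1 0 : ℂ) * w + A 1 1) := by
    have : (A • w).im = ((A • w : ℍ) : ℂ).im := rfl
    rw [this, coe_smul', Complex.div_im]
    have hn : Complex.normSq ((A 1 0 : ℂ) * w + A 1 1) ≠ 0 := by simpa using hd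
    rw [← sub_div, div_left_inj' hn]
    simp
    linear_combination w.im * det2 A
  rw [UpperHalfPlane.cosh_dist, him, Complex.dist_eq, coe_smul']
  have hn : Complex.normSq ((A 1 0 : ℂ) * w + A 1 1) ≠ 0 := by simpa using hd
  have e : (z : ℂ) - ((A 0 0 : ℂ) * w + A 0 1) / ((A 1 0 : ℂ) * w + A 1 1) =
    ((z : ℂ) * ((A 1 0 : ℂ) * w + A 1 1) - ((A 0 0 : ℂ) * w + A 0 1)) /
      ((A 1 0 : ℂ) * w + A 1 1) := by
    rw [sub_div, mul_div_assoc, div_self hd, mul_one]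
  rw [e, ← Complex.normSq_eq_norm_sq, Complex.normSq_div]
  have := z.im_ne_zero
  have := w.im_ne_zero
  field_simp

def mm1 (R : ℝ) (A : SL2) : ℝ := A 0 0 * R + A 0 1 + A 1 0 + A 1 1 / R
def mm2 (R : ℝ) (A : SL2) : ℝ := A 0 0 * R + A 0 1 - A 1 0 - A 1 1 / R
def mm3 (R : ℝ) (A : SL2) : ℝ := A 0 0 * R - A 0 1 + A 1 0 - A 1 1 / R
def mm4 (R : ℝ) (A : SL2) : ℝ := A 0 0 * R - A 0 1 - A 1 0 + A 1 1 / R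

/-- The preferred lifts of the elements of `C0`. -/
def UU (R : ℝ) : Set SL2 := {A | R + 1 / R < mm1 R A ∧ R - 1 / R < mm2 R A ∧
  R - 1 / R < mm3 R A ∧ R + 1 / R < mm4 R A}

theorem circ_sq {r : ℝ} {z : ℍ} (h : z ∈ circ r) : z.re ^ 2 + z.im ^ 2 = r ^ 2 := by
  have h' : ‖(z : ℂ)‖ = r := h
  rw [← h', ← Complex.normSq_eq_norm_sq, Complex.normSq_apply]
  simp only [UpperHalfPlane.coe_re, UpperHalfPlane.coe_im]
  ring

theorem circ_pt {r T : ℝ} (hr : 0 < r) (h1 : -1 < T) (h2 : T < 1) :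
    ∃ z : ℍ, z ∈ circ r ∧ z.re = r * T := by
  have hp : 0 < 1 - T ^ 2 := by nlinarith
  refine ⟨⟨⟨r * T, r * √(1 - T ^ 2)⟩, by
    have := Real.sqrt_pos.mpr hp
    show 0 < r * √(1 - T ^ 2)
    positivity⟩, ?_, rfl⟩
  show ‖(⟨r * T, r * √(1 - T ^ 2)⟩ : ℂ)‖ = r
  rw [← sq_eq_sq₀ (norm_nonneg _) hr.le, ← Complex.normSq_eq_norm_sq, Complex.normSq_mk]
  have := Real.sq_sqrt hp.le
  linear_combination r ^ 2 * this

theorem cosh_corner (R : ℝ) (hR : 1 < R) (A : SL2) {z w : ℍ} (hz : z ∈ circ (1 / R))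
    (hw : w ∈ circ R) :
    4 * (Real.cosh (dist z (A • w)) * (2 * z.im * w.im)) =
      (1 + z.re * R) * (1 + w.re / R) * mm2 R A ^ 2 +
      (1 - z.re * R) * (1 + w.re / R) * mm1 R A ^ 2 +
      (1 + z.re * R) * (1 - w.re / R) * mm4 R A ^ 2 +
      (1 - z.re * R) * (1 - w.re / R) * mm3 R A ^ 2 := by
  have hz := circ_sq hz
  have hw := circ_sq hw
  have hd := det2 A
  have hR0 : R ≠ 0 := by positivity
  rw [cosh_smul, Complex.normSq_apply]
  simp only [Complex.sub_re, Complex.sub_im, Complex.mul_re, Complex.mul_im, Complex.add_re,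
    Complex.add_im, Complex.ofReal_re, Complex.ofReal_im, UpperHalfPlane.coe_re,
    UpperHalfPlane.coe_im, mm1, mm2, mm3, mm4]
  generalize A 0 0 = a at *
  generalize A 0 1 = b at *
  generalize A 1 0 = c at *
  generalize A 1 1 = d at *
  generalize z.re = x at *
  generalize z.im = y at *
  generalize w.re = u at *
  generalize w.im = v at *
  linear_combination (norm := (field_simp; ring)) 4 * (c ^ 2 * (u ^ 2 + v ^ 2) + 2 * c * d * u + d ^ 2) * hz
    + 4 * (c ^ 2 / R ^ 2 + a ^ 2 - 2 * x * a * c) * hw - 8 * y * v * hd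

theorem pos_iff_aux {k x y : ℝ} (hk : 0 < k) (h : x = k * y) : 0 < x ↔ 0 < y := by
  rw [h]; exact mul_pos_iff_of_pos_left hk

theorem neg_iff_aux {k x y : ℝ} (hk : 0 < k) (h : x = k * y) : x < 0 ↔ y < 0 := by
  have := pos_iff_aux (x := -x) (y := -y) hk (by rw [h]; ring)
  simpa using this

theorem norm_corner (R : ℝ) (hR : 1 < R) (A : SL2) {w : ℍ} (hw : w ∈ circ R) :
    1 / R < ‖((A • w : ℍ) : ℂ)‖ ↔
      0 < (1 + w.re / R) * (mm1 R A * mm2 R A) + (1 - w.re / R) * (mm3 R A * mm4 R A) := by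
  have hw := circ_sq hw
  have hR0 : 0 < R := by positivity
  have hd := denom_ne A w
  rw [coe_smul', norm_div, div_lt_div_iff₀ hR0 (norm_pos_iff.mpr hd), one_mul,
    ← sq_lt_sq₀ (norm_nonneg _) (by positivity), mul_pow, ← Complex.normSq_eq_norm_sq,
    ← Complex.normSq_eq_norm_sq, ← sub_pos, Complex.normSq_apply, Complex.normSq_apply]
  simp only [Complex.mul_re, Complex.mul_im, Complex.add_re,
    Complex.add_im, Complex.ofReal_re, Complex.ofReal_im, UpperHalfPlane.coe_re,
    UpperHalfPlane.coe_im, mm1, mm2, mm3, mm4]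
  generalize A 0 0 = a at *
  generalize A 0 1 = b at *
  generalize A 1 0 = c at *
  generalize A 1 1 = d at *
  generalize w.re = u at *
  generalize w.im = v at *
  refine pos_iff_aux (show 0 < R ^ 2 / 2 by positivity) ?_
  linear_combination (norm := (field_simp; ring)) (a ^ 2 * R ^ 2 - c ^ 2) * hw

theorem norm_corner_inv (R : ℝ) (hR : 1 < R) (A : SL2) {z : ℍ} (hz : z ∈ circ (1 / R)) :
    R < ‖((A⁻¹ • z : ℍ) : ℂ)‖ ↔
      (1 + z.re * R) * (mm2 R A * mm4 R A) + (1 - z.re * R) * (mm1 R A * mm3 R A) < 0 := by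
  have hz := circ_sq hz
  have hR0 : 0 < R := by positivity
  have hd := denom_ne A⁻¹ z
  rw [coe_smul', norm_div, lt_div_iff₀ (norm_pos_iff.mpr hd),
    ← sq_lt_sq₀ (by positivity) (norm_nonneg _), mul_pow, ← Complex.normSq_eq_norm_sq,
    ← Complex.normSq_eq_norm_sq, ← sub_neg, Complex.normSq_apply, Complex.normSq_apply]
  simp only [Matrix.SpecialLinearGroup.SL2_inv_expl, Complex.mul_re, Complex.mul_im, Complex.add_re,
    Complex.add_im, Complex.ofReal_re, Complex.ofReal_im, UpperHalfPlane.coe_re,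
    UpperHalfPlane.coe_im, mm1, mm2, mm3, mm4, Matrix.cons_val',
     Matrix.cons_val_zero, Matrix.cons_val_one, Matrix.cons_val_fin_one]
  generalize A 0 0 = a at *
  generalize A 0 1 = b at *
  generalize A 1 0 = c at *
  generalize A 1 1 = d at *
  generalize z.re = x at *
  generalize z.im = y at *
  refine neg_iff_aux (show 0 < (1 : ℝ) / 2 by positivity) ?_
  linear_combination (norm := (field_simp; ring)) (c ^ 2 * R ^ 2 - d ^ 2) * hz

theorem lin_corner {a b : ℝ} (h : ∀ T : ℝ, -1 < T → T < 1 → 0 ≤ (1 + T) * a + (1 - T) * b) :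
    0 ≤ a ∧ 0 ≤ b := by
  have hc : IsClosed {T : ℝ | 0 ≤ (1 + T) * a + (1 - T) * b} :=
    isClosed_le continuous_const (by fun_prop)
  have hs : Set.Ioo (-1 : ℝ) 1 ⊆ {T : ℝ | 0 ≤ (1 + T) * a + (1 - T) * b} :=
    fun T hT => h T hT.1 hT.2
  have := hc.closure_subset_iff.mpr hs
  rw [closure_Ioo (by norm_num)] at this
  have h1 := this (show (1 : ℝ) ∈ Set.Icc (-1 : ℝ) 1 by norm_num)
  have h2 := this (show (-1 : ℝ) ∈ Set.Icc (-1 : ℝ) 1 by norm_num)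
  simp only [Set.mem_ofPred_eq] at h1 h2
  constructor <;> linarith

theorem bilin_corner {a b c d : ℝ} (h : ∀ T T' : ℝ, -1 < T → T < 1 → -1 < T' → T' < 1 →
    0 ≤ (1 + T) * (1 + T') * a + (1 - T) * (1 + T') * b + (1 + T) * (1 - T') * c +
      (1 - T) * (1 - T') * d) : 0 ≤ a ∧ 0 ≤ b ∧ 0 ≤ c ∧ 0 ≤ d := by
  have key : ∀ T : ℝ, -1 < T → T < 1 → 0 ≤ (1 + T) * a + (1 - T) * b ∧
      0 ≤ (1 + T) * c + (1 - T) * d := by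
    intro T h1 h2
    apply lin_corner
    intro T' h1' h2'
    have := h T T' h1 h2 h1' h2'
    linarith
  obtain ⟨ha, hb⟩ := lin_corner fun T h1 h2 => (key T h1 h2).1
  obtain ⟨hc, hd⟩ := lin_corner fun T h1 h2 => (key T h1 h2).2
  exact ⟨ha, hb, hc, hd⟩

def CC0 (R : ℝ) : Set PSL2 := {h : PSL2 |
      (∃ c > 0, ∀ x ∈ circ (1 / R), ∀ x' ∈ circ R,
        c ≤ dist x (pslSMul h x') - dist x x') ∧
      pslImg h (circ R) ⊆ {z : ℍ | 1 / R < ‖(z : ℂ)‖} ∧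
      circ (1 / R) ∩ pslImg h {z : ℍ | R < ‖(z : ℂ)‖} = ∅}

theorem mm_neg (R : ℝ) (A : SL2) : mm1 R (-A) = - mm1 R A ∧ mm2 R (-A) = - mm2 R A ∧
    mm3 R (-A) = - mm3 R A ∧ mm4 R (-A) = - mm4 R A := by
  simp only [mm1, mm2, mm3, mm4, Matrix.SpecialLinearGroup.coe_neg, Matrix.neg_apply]
  refine ⟨?_, ?_, ?_, ?_⟩ <;> ring

theorem cosh_corner_one (R : ℝ) (hR : 1 < R) {z w : ℍ} (hz : z ∈ circ (1 / R))
    (hw : w ∈ circ R) :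
    4 * (Real.cosh (dist z w) * (2 * z.im * w.im)) =
      (1 + z.re * R) * (1 + w.re / R) * (R - 1 / R) ^ 2 +
      (1 - z.re * R) * (1 + w.re / R) * (R + 1 / R) ^ 2 +
      (1 + z.re * R) * (1 - w.re / R) * (R + 1 / R) ^ 2 +
      (1 - z.re * R) * (1 - w.re / R) * (R - 1 / R) ^ 2 := by
  have := cosh_corner R hR 1 hz hw
  simpa [mm1, mm2, mm3, mm4] using this

theorem circ_range {R : ℝ} (hR : 1 < R) {z w : ℍ} (hz : z ∈ circ (1 / R)) (hw : w ∈ circ R) :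
    (0 < 1 + z.re * R ∧ 0 < 1 - z.re * R) ∧ (0 < 1 + w.re / R ∧ 0 < 1 - w.re / R) := by
  have hz' := circ_sq hz
  have hw' := circ_sq hw
  have hR0 : 0 < R := by positivity
  have h1 : |z.re * R| < 1 := by
    rw [← sq_lt_one_iff_abs_lt_one]
    have : z.re ^ 2 * R ^ 2 + z.im ^ 2 * R ^ 2 = 1 := by
      rw [← add_mul, hz']; field_simp
    have h3 : 0 < z.im ^ 2 * R ^ 2 := by have := z.im_pos; positivity
    nlinarith
  have h2 : |w.re / R| < 1 := by
    rw [abs_div, abs_of_pos hR0, div_lt_one hR0]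
    apply abs_lt_of_sq_lt_sq _ hR0.le
    have := w.im_pos
    nlinarith
  rw [abs_lt] at h1 h2
  refine ⟨⟨by linarith, by linarith⟩, by linarith, by linarith⟩

theorem cond1_iff (R : ℝ) (hR : 1 < R) (A : SL2) :
    (∃ c > 0, ∀ x ∈ circ (1 / R), ∀ x' ∈ circ R, c ≤ dist x (A • x') - dist x x') ↔
      (R + 1 / R) ^ 2 < mm1 R A ^ 2 ∧ (R - 1 / R) ^ 2 < mm2 R A ^ 2 ∧
      (R - 1 / R) ^ 2 < mm3 R A ^ 2 ∧ (R + 1 / R) ^ 2 < mm4 R A ^ 2 := by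
  have hR0 : 0 < R := by positivity
  have hRm : 0 < R - 1 / R := by
    rw [sub_pos, div_lt_iff₀ hR0]; nlinarith
  have hRp : 0 < R + 1 / R := by positivity
  constructor
  · rintro ⟨c, hc, h⟩
    have hcc : 1 < Real.cosh c := Real.one_lt_cosh.mpr hc.ne'
    have key : ∀ T T' : ℝ, -1 < T → T < 1 → -1 < T' → T' < 1 →
      0 ≤ (1 + T) * (1 + T') * (mm2 R A ^ 2 - Real.cosh c * (R - 1 / R) ^ 2) +
        (1 - T) * (1 + T') * (mm1 R A ^ 2 - Real.cosh c * (R + 1 / R) ^ 2) +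
        (1 + T) * (1 - T') * (mm4 R A ^ 2 - Real.cosh c * (R + 1 / R) ^ 2) +
        (1 - T) * (1 - T') * (mm3 R A ^ 2 - Real.cosh c * (R - 1 / R) ^ 2) := by
      intro T T' h1 h2 h3 h4
      obtain ⟨z, hz, hzr⟩ := circ_pt (r := 1 / R) (by positivity) h1 h2
      obtain ⟨w, hw, hwr⟩ := circ_pt hR0 h3 h4
      have hh := h z hz w hw
      have e1 := cosh_corner R hR A hz hw
      have e2 := cosh_corner_one R hR hz hw
      have t1 : z.re * R = T := by rw [hzr]; field_simp
      have t2 : w.re / R = T' := by rw [hwr]; field_simp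
      rw [t1, t2] at e1 e2
      have d0 : 0 ≤ dist z w := dist_nonneg
      have l1 : Real.cosh (dist z w + c) ≤ Real.cosh (dist z (A • w)) := by
        rw [Real.cosh_le_cosh, abs_of_nonneg (by linarith), abs_of_nonneg dist_nonneg]
        linarith
      have l2 : Real.cosh c * Real.cosh (dist z w) ≤ Real.cosh (dist z w + c) := by
        rw [Real.cosh_add]
        have : 0 ≤ Real.sinh (dist z w) * Real.sinh c :=
          mul_nonneg (Real.sinh_nonneg_iff.mpr d0) (Real.sinh_nonneg_iff.mpr hc.le)
        linarith
      have hp : 0 < 2 * z.im * w.im := by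
        have := z.im_pos
        have := w.im_pos
        positivity
      have l3 := mul_le_mul_of_nonneg_right (l2.trans l1) hp.le
      linear_combination 4 * l3 + e1 - Real.cosh c * e2
    obtain ⟨k2, k1, k4, k3⟩ := bilin_corner key
    have s1 : 0 < (R - 1 / R) ^ 2 := by positivity
    have s2 : 0 < (R + 1 / R) ^ 2 := by positivity
    refine ⟨?_, ?_, ?_, ?_⟩ <;> nlinarith
  · rintro ⟨h1, h2, h3, h4⟩
    have ex : ∀ x y : ℝ, 0 < x → x < y → ∃ k > 1, k * x ≤ y := by
      intro x y hx hxy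
      exact ⟨y / x, by rw [gt_iff_lt, one_lt_div hx]; exact hxy, by field_simp; rfl⟩
    obtain ⟨k1, hk1, g1⟩ := ex _ _ (by positivity) h1
    obtain ⟨k2, hk2, g2⟩ := ex _ _ (by positivity) h2
    obtain ⟨k3, hk3, g3⟩ := ex _ _ (by positivity) h3
    obtain ⟨k4, hk4, g4⟩ := ex _ _ (by positivity) h4
    obtain ⟨k, hk, f1, f2, f3, f4⟩ : ∃ k > 1, k ≤ k1 ∧ k ≤ k2 ∧ k ≤ k3 ∧ k ≤ k4 :=
      ⟨min (min k1 k2) (min k3 k4), by simp [hk1, hk2, hk3, hk4], by simp, by simp, by simp,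
        by simp⟩
    have s1 : 0 < (R - 1 / R) ^ 2 := by positivity
    have s2 : 0 < (R + 1 / R) ^ 2 := by positivity
    replace g1 : k * (R + 1 / R) ^ 2 ≤ mm1 R A ^ 2 := le_trans (by gcongr) g1
    replace g2 : k * (R - 1 / R) ^ 2 ≤ mm2 R A ^ 2 := le_trans (by gcongr) g2
    replace g3 : k * (R - 1 / R) ^ 2 ≤ mm3 R A ^ 2 := le_trans (by gcongr) g3
    replace g4 : k * (R + 1 / R) ^ 2 ≤ mm4 R A ^ 2 := le_trans (by gcongr) g4
    have hk0 : 0 < k := by linarith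
    have hlog := Real.log_pos hk
    refine ⟨Real.log k, hlog, fun z hz w hw => ?_⟩
    have e1 := cosh_corner R hR A hz hw
    have e2 := cosh_corner_one R hR hz hw
    obtain ⟨⟨b1, b2⟩, b3, b4⟩ := circ_range hR hz hw
    have hp : 0 < 2 * z.im * w.im := by
      have := z.im_pos
      have := w.im_pos
      positivity
    have l1 : k * Real.cosh (dist z w) ≤ Real.cosh (dist z (A • w)) := by
      refine le_of_mul_le_mul_right ?_ hp
      have n1 := mul_le_mul_of_nonneg_left g1 (mul_pos b2 b3).le
      have n2 := mul_le_mul_of_nonneg_left g2 (mul_pos b1 b3).le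
      have n3 := mul_le_mul_of_nonneg_left g3 (mul_pos b2 b4).le
      have n4 := mul_le_mul_of_nonneg_left g4 (mul_pos b1 b4).le
      linear_combination (1 / 4) * (n1 + n2 + n3 + n4 - e1 + k * e2)
    have l2 : Real.cosh (dist z w + Real.log k) ≤ k * Real.cosh (dist z w) := by
      rw [Real.cosh_eq, Real.cosh_eq, neg_add, Real.exp_add, Real.exp_add, Real.exp_log hk0,
        Real.exp_neg (Real.log k), Real.exp_log hk0]
      have : k⁻¹ ≤ k := (inv_le_one_of_one_le₀ hk.le).trans hk.le
      have := mul_le_mul_of_nonneg_left this (Real.exp_pos (-dist z w)).le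
      linarith
    have l3 := l2.trans l1
    rw [Real.cosh_le_cosh, abs_of_nonneg (by positivity), abs_of_nonneg dist_nonneg] at l3
    linarith

theorem mk_mem_CC0 (R : ℝ) (hR : 1 < R) (A : SL2) :
    (QuotientGroup.mk A : PSL2) ∈ CC0 R ↔ A ∈ UU R ∨ -A ∈ UU R := by
  have hR0 : 0 < R := by positivity
  have hRm : 0 < R - 1 / R := by
    rw [sub_pos, div_lt_iff₀ hR0]; nlinarith
  have hRp : 0 < R + 1 / R := by positivity
  have c1 := cond1_iff R hR A
  have c2 : pslImg (QuotientGroup.mk A : PSL2) (circ R) ⊆ {z : ℍ | 1 / R < ‖(z : ℂ)‖} ↔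
      ∀ w ∈ circ R, 0 < (1 + w.re / R) * (mm1 R A * mm2 R A) +
        (1 - w.re / R) * (mm3 R A * mm4 R A) := by
    unfold pslImg
    rw [Set.image_subset_iff]
    refine forall₂_congr fun w hw => ?_
    rw [← norm_corner R hR A hw, Set.mem_preimage, pslSMul_mk]
    rfl
  have c3 : circ (1 / R) ∩ pslImg (QuotientGroup.mk A : PSL2) {z : ℍ | R < ‖(z : ℂ)‖} = ∅ ↔
      ∀ z ∈ circ (1 / R), 0 ≤ (1 + z.re * R) * (mm2 R A * mm4 R A) +
        (1 - z.re * R) * (mm1 R A * mm3 R A) := by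
    rw [Set.eq_empty_iff_forall_notMem]
    constructor
    · intro h z hz
      by_contra hn
      rw [not_le, ← norm_corner_inv R hR A hz] at hn
      refine h z ⟨hz, A⁻¹ • z, hn, ?_⟩
      rw [pslSMul_mk, smul_inv_smul]
    · rintro h z ⟨hz, w, hw, hwz⟩
      rw [pslSMul_mk] at hwz
      refine absurd (h z hz) (not_le.mpr ?_)
      rw [← norm_corner_inv R hR A hz, ← hwz, inv_smul_smul]
      exact hw
  have c0 : (QuotientGroup.mk A : PSL2) ∈ CC0 R ↔ _ ∧ _ ∧ _ :=
    and_congr (by simp only [pslSMul_mk]; exact c1) (and_congr c2 c3)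
  rw [c0]
  obtain ⟨q1, q2, q3, q4⟩ := mm_neg R A
  have hU : -A ∈ UU R ↔ R + 1 / R < -mm1 R A ∧ R - 1 / R < -mm2 R A ∧
      R - 1 / R < -mm3 R A ∧ R + 1 / R < -mm4 R A := by
    unfold UU
    rw [Set.mem_ofPred_eq, q1, q2, q3, q4]
  rw [hU]
  change _ ↔ (R + 1 / R < mm1 R A ∧ R - 1 / R < mm2 R A ∧
      R - 1 / R < mm3 R A ∧ R + 1 / R < mm4 R A) ∨ _
  generalize mm1 R A = m1 at *
  generalize mm2 R A = m2 at *
  generalize mm3 R A = m3 at *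
  generalize mm4 R A = m4 at *
  generalize R + 1 / R = S at *
  generalize R - 1 / R = D at *
  constructor
  · rintro ⟨⟨h1, h2, h3, h4⟩, h5, h6⟩
    have p1 := lin_corner (a := m1 * m2) (b := m3 * m4) (fun T t1 t2 => by
      obtain ⟨w, hw, hwr⟩ := circ_pt hR0 t1 t2
      have := h5 w hw
      have e : w.re / R = T := by rw [hwr]; field_simp
      rw [e] at this
      exact this.le)
    have p2 := lin_corner (a := m2 * m4) (b := m1 * m3) (fun T t1 t2 => by
      obtain ⟨w, hw, hwr⟩ := circ_pt (r := 1 / R) (by positivity) t1 t2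
      have := h6 w hw
      have e : w.re * R = T := by rw [hwr]; field_simp
      rw [e] at this
      exact this)
    have ab : ∀ s m : ℝ, 0 < s → s ^ 2 < m ^ 2 → s < m ∨ s < -m := by
      intro s m hs hm
      rw [sq_lt_sq, abs_of_pos hs, lt_abs] at hm
      exact hm
    obtain ⟨x1, x2⟩ := p1
    obtain ⟨x3, x4⟩ := p2
    rcases ab _ _ hRp h1 with g1 | g1
    · left
      have y2 : 0 ≤ m2 := nonneg_of_mul_nonneg_right x1 (by linarith)
      have y3 : 0 ≤ m3 := nonneg_of_mul_nonneg_right x4 (by linarith)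
      have y2' : D < m2 := (ab _ _ hRm h2).resolve_right (by linarith)
      have y3' : D < m3 := (ab _ _ hRm h3).resolve_right (by linarith)
      have y4 : 0 ≤ m4 := nonneg_of_mul_nonneg_right x2 (by linarith)
      exact ⟨g1, y2', y3', (ab _ _ hRp h4).resolve_right (by linarith)⟩
    · right
      have y2 : 0 ≤ -m2 := nonneg_of_mul_nonneg_right (a := -m1) (by linarith) (by linarith)
      have y3 : 0 ≤ -m3 := nonneg_of_mul_nonneg_right (a := -m1) (by linarith) (by linarith)
      have y2' : D < -m2 := (ab _ _ hRm h2).resolve_left (by linarith)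
      have y3' : D < -m3 := (ab _ _ hRm h3).resolve_left (by linarith)
      have y4 : 0 ≤ -m4 := nonneg_of_mul_nonneg_right (a := -m3) (by linarith) (by linarith)
      exact ⟨g1, y2', y3', (ab _ _ hRp h4).resolve_left (by linarith)⟩
  · intro h
    have pos : (0 < m1 * m2 ∧ 0 < m3 * m4 ∧ 0 < m2 * m4 ∧ 0 < m1 * m3) ∧ 
        (S ^ 2 < m1 ^ 2 ∧ D ^ 2 < m2 ^ 2 ∧ D ^ 2 < m3 ^ 2 ∧ S ^ 2 < m4 ^ 2) := by
      rcases h with ⟨h1, h2, h3, h4⟩ | ⟨h1, h2, h3, h4⟩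
      · refine ⟨⟨?_, ?_, ?_, ?_⟩, ?_, ?_, ?_, ?_⟩ <;> nlinarith
      · refine ⟨⟨?_, ?_, ?_, ?_⟩, ?_, ?_, ?_, ?_⟩ <;> nlinarith
    obtain ⟨⟨x1, x2, x3, x4⟩, hs⟩ := pos
    refine ⟨hs, fun w hw => ?_, fun z hz => ?_⟩
    · obtain ⟨z, hz, -⟩ := circ_pt (r := 1 / R) (T := 0) (by positivity) (by norm_num) (by norm_num)
      obtain ⟨⟨b1, b2⟩, b3, b4⟩ := circ_range hR hz hw
      positivity
    · obtain ⟨w, hw, -⟩ := circ_pt (r := R) (T := 0) (by positivity) (by norm_num) (by norm_num)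
      obtain ⟨⟨b1, b2⟩, b3, b4⟩ := circ_range hR hz hw
      positivity

theorem UU_pos {R : ℝ} (hR : 1 < R) : 0 < R - 1 / R ∧ 0 < R + 1 / R ∧ R - 1 / R < R + 1 / R := by
  have hR0 : 0 < R := by positivity
  have hi : 0 < 1 / R := by positivity
  refine ⟨?_, by positivity, by linarith⟩
  rw [sub_pos, div_lt_iff₀ hR0]; nlinarith

/-- One parametrization of the boundary of the stem quadrant. -/
def PtM (R : ℝ) (hR : 1 < R) (τ : ℝ) : SL2 :=
  ⟨!![1 + |τ|, -R * τ; τ / R, 1 - |τ|], by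
    rw [Matrix.det_fin_two_of]
    have hR0 : R ≠ 0 := by positivity
    have := abs_mul_abs_self τ
    field_simp
    linear_combination -this⟩

def QQ (R : ℝ) : Set SL2 := {B | ∃ α β v : ℝ,
  (B : Matrix (Fin 2) (Fin 2) ℝ) = !![β, v / R; -v * R, α] ∧ |α| < β ∧ 2 * |v| < β - α}

def FF (R : ℝ) (A : SL2) : ℝ :=
  (R + 1 / R) * (mm1 R A - mm4 R A) + (R - 1 / R) * (mm2 R A - mm3 R A)

def tau (R : ℝ) (A : SL2) : ℝ :=
  - min (FF R A) 0 / (2 * ((R + 1 / R) * mm2 R A + (R - 1 / R) * mm1 R A))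
  - max (FF R A) 0 / (2 * ((R + 1 / R) * mm3 R A + (R - 1 / R) * mm4 R A))

theorem mul_entries (A B : SL2) (i j : Fin 2) : (A * B) i j = A i 0 * B 0 j + A i 1 * B 1 j := by
  rw [Matrix.SpecialLinearGroup.coe_mul, Matrix.mul_apply, Fin.sum_univ_two]

theorem mm_mul_nonneg (R : ℝ) (hR : 1 < R) (B : SL2) (τ : ℝ) (h : 0 ≤ τ) :
    mm1 R (B * PtM R hR τ) = mm1 R B ∧ mm2 R (B * PtM R hR τ) = mm2 R B ∧
    mm3 R (B * PtM R hR τ) = mm3 R B + 2 * τ * mm1 R B ∧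
    mm4 R (B * PtM R hR τ) = mm4 R B + 2 * τ * mm2 R B := by
  have hR0 : R ≠ 0 := by positivity
  simp only [mm1, mm2, mm3, mm4, mul_entries]
  simp only [PtM, abs_of_nonneg h, Matrix.of_apply, Matrix.cons_val', Matrix.cons_val_zero,
    Matrix.cons_val_one, Matrix.cons_val_fin_one]
  refine ⟨?_, ?_, ?_, ?_⟩ <;> field_simp <;> ring

theorem mm_mul_nonpos (R : ℝ) (hR : 1 < R) (B : SL2) (τ : ℝ) (h : τ ≤ 0) :
    mm1 R (B * PtM R hR τ) = mm1 R B - 2 * τ * mm3 R B ∧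
    mm2 R (B * PtM R hR τ) = mm2 R B - 2 * τ * mm4 R B ∧
    mm3 R (B * PtM R hR τ) = mm3 R B ∧
    mm4 R (B * PtM R hR τ) = mm4 R B := by
  have hR0 : R ≠ 0 := by positivity
  simp only [mm1, mm2, mm3, mm4, mul_entries]
  simp only [PtM, abs_of_nonpos h, Matrix.of_apply, Matrix.cons_val', Matrix.cons_val_zero,
    Matrix.cons_val_one, Matrix.cons_val_fin_one]
  refine ⟨?_, ?_, ?_, ?_⟩ <;> field_simp <;> ring

theorem FF_eq (R : ℝ) (hR : 1 < R) (B : SL2) : FF R B = 4 * (R * B 0 1 + B 1 0 / R) := by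
  have hR0 : R ≠ 0 := by positivity
  simp only [FF, mm1, mm2, mm3, mm4]
  field_simp
  ring

theorem quad_core {κ l w D S : ℝ} (hD : 0 < D) (hS : 0 < S) (h : w ^ 2 = 1 + κ * l)
    (h1 : D < w * D + κ * S) (h2 : S < w * S + l * D) : 0 < κ ∧ 0 < l ∧ 0 < w := by
  have e : (w - 1) * (w + 1) = κ * l := by linear_combination h
  have w1 : 1 < w := by
    by_contra hw
    have hw : 0 ≤ 1 - w := by linarith
    have a1 : (1 - w) * D < κ * S := by linarith
    have a2 : (1 - w) * S < l * D := by linarith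
    have := mul_lt_mul'' a1 a2 (by positivity) (by positivity)
    have : (1 - w) ^ 2 * (D * S) < κ * l * (D * S) := by linarith
    have := lt_of_mul_lt_mul_right this (by positivity)
    nlinarith
  have kl : 0 < κ * l := by rw [← e]; nlinarith
  have kp : 0 < κ := by
    by_contra hk
    have hk : κ ≤ 0 := not_lt.mp hk
    have hk : κ < 0 := lt_of_le_of_ne hk (by rintro rfl; simp at kl)
    have hl : l < 0 := by
      by_contra hl
      nlinarith
    have a1 : -κ * S < (w - 1) * D := by linarith
    have a2 : -l * D < (w - 1) * S := by linarith
    have := mul_lt_mul'' a1 a2 (by nlinarith) (by nlinarith)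
    have : κ * l * (D * S) < (w - 1) ^ 2 * (D * S) := by linarith
    have := lt_of_mul_lt_mul_right this (by positivity)
    nlinarith
  exact ⟨kp, pos_of_mul_pos_right kl kp.le, by linarith⟩

/-- `FF = 0` together with two inequalities puts a matrix into the normalized quadrant. -/
theorem mem_QQ (R : ℝ) (hR : 1 < R) (B : SL2) (hF : FF R B = 0)
    (h : (R + 1 / R < mm1 R B ∧ R - 1 / R < mm2 R B) ∨
      (R - 1 / R < mm3 R B ∧ R + 1 / R < mm4 R B)) : B ∈ QQ R := by
  have hR0 : R ≠ 0 := by positivity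
  obtain ⟨hD, hS, -⟩ := UU_pos hR
  rw [FF_eq R hR] at hF
  have hc : B 1 0 = - (R * B 0 1) * R := by
    field_simp at hF
    linear_combination (1 / 4) * hF
  have hdet := det2 B
  have key : 0 < (B 0 0 - B 1 1) / 2 + R * B 0 1 ∧ 0 < (B 0 0 - B 1 1) / 2 - R * B 0 1 ∧
      0 < (B 0 0 + B 1 1) / 2 := by
    rcases h with ⟨h1, h2⟩ | ⟨h1, h2⟩
    · apply quad_core hD hS
      · rw [hc] at hdet; linear_combination hdet
      · simp only [mm2, hc] at h2; convert h2 using 1; field_simp; ring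
      · simp only [mm1, hc] at h1; convert h1 using 1; field_simp; ring
    · rw [and_left_comm]
      apply quad_core hD hS
      · rw [hc] at hdet; linear_combination hdet
      · simp only [mm3, hc] at h1; convert h1 using 1; field_simp; ring
      · simp only [mm4, hc] at h2; convert h2 using 1; field_simp; ring
  obtain ⟨k1, k2, k3⟩ := key
  refine ⟨B 1 1, B 0 0, R * B 0 1, ?_, ?_, ?_⟩
  · ext i j
    fin_cases i <;> fin_cases j <;> simp [hc]
    field_simp
  · rw [abs_lt]; constructor <;> linarith
  · have : |R * B 0 1| < (B 0 0 - B 1 1) / 2 := by rw [abs_lt]; constructor <;> linarith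
    linarith

theorem tau_of_nonpos {R : ℝ} {A : SL2} (h : FF R A ≤ 0) :
    tau R A = -FF R A / (2 * ((R + 1 / R) * mm2 R A + (R - 1 / R) * mm1 R A)) := by
  simp [tau, min_eq_left h, max_eq_right h]

theorem tau_of_nonneg {R : ℝ} {A : SL2} (h : 0 ≤ FF R A) :
    tau R A = -(FF R A / (2 * ((R + 1 / R) * mm3 R A + (R - 1 / R) * mm4 R A))) := by
  simp [tau, min_eq_right h, max_eq_left h]

theorem UU_QQ (R : ℝ) (hR : 1 < R) (A : SL2) (hA : A ∈ UU R) :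
    A * (PtM R hR (tau R A))⁻¹ ∈ QQ R := by
  obtain ⟨hD, hS, -⟩ := UU_pos hR
  obtain ⟨h1, h2, h3, h4⟩ := hA
  generalize hB : A * (PtM R hR (tau R A))⁻¹ = B
  have hAB : A = B * PtM R hR (tau R A) := by rw [← hB]; simp
  rcases le_total (FF R A) 0 with hF | hF
  · have ht := tau_of_nonpos hF
    have hp : 0 < (R + 1 / R) * mm2 R A + (R - 1 / R) * mm1 R A := by nlinarith
    have ht0 : 0 ≤ tau R A := by
      rw [ht]; apply div_nonneg <;> linarith
    obtain ⟨e1, e2, e3, e4⟩ := mm_mul_nonneg R hR B _ ht0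
    rw [← hAB] at e1 e2 e3 e4
    apply mem_QQ R hR
    · rw [eq_div_iff (by positivity)] at ht
      rw [FF] at ht ⊢
      rw [e3, e4, e1, e2] at ht
      linear_combination ht
    · left; rw [← e1, ← e2]; exact ⟨h1, h2⟩
  · have ht := tau_of_nonneg hF
    have hp : 0 < (R + 1 / R) * mm3 R A + (R - 1 / R) * mm4 R A := by nlinarith
    have ht0 : tau R A ≤ 0 := by
      rw [ht, neg_nonpos]; apply div_nonneg <;> linarith
    obtain ⟨e1, e2, e3, e4⟩ := mm_mul_nonpos R hR B _ ht0
    rw [← hAB] at e1 e2 e3 e4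
    apply mem_QQ R hR
    · rw [← neg_div, eq_div_iff (by positivity)] at ht
      rw [FF] at ht ⊢
      rw [e3, e4, e1, e2] at ht
      linear_combination ht
    · right; rw [← e3, ← e4]; exact ⟨h3, h4⟩

theorem QQ_UU (R : ℝ) (hR : 1 < R) (B : SL2) (hB : B ∈ QQ R) (τ : ℝ) :
    B * PtM R hR τ ∈ UU R ∧ tau R (B * PtM R hR τ) = τ := by
  have hR0 : R ≠ 0 := by positivity
  obtain ⟨hD, hS, -⟩ := UU_pos hR
  obtain ⟨α, β, v, hM, h1, h2⟩ := hB
  have hdet := det2 B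
  have b00 : B 0 0 = β := by rw [hM]; simp
  have b01 : B 0 1 = v / R := by rw [hM]; simp
  have b10 : B 1 0 = -v * R := by rw [hM]; simp
  have b11 : B 1 1 = α := by rw [hM]; simp
  rw [b00, b01, b10, b11] at hdet
  have hF : FF R B = 0 := by rw [FF_eq R hR, b01, b10]; field_simp; ring
  have hk : |v| < (β - α) / 2 := by linarith
  rw [abs_lt] at hk h1
  obtain ⟨κ, hκ⟩ : ∃ κ, κ = (β - α) / 2 + v := ⟨_, rfl⟩
  obtain ⟨l, hl⟩ : ∃ l, l = (β - α) / 2 - v := ⟨_, rfl⟩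
  obtain ⟨w, hw⟩ : ∃ w, w = (β + α) / 2 := ⟨_, rfl⟩
  have k0 : 0 < κ := by linarith
  have l0 : 0 < l := by linarith
  have w0 : 0 < w := by linarith
  have hdet' : w ^ 2 = 1 + κ * l := by
    rw [hκ, hl, hw]; field_simp at hdet; linear_combination hdet
  have w1 : 1 < w := by nlinarith [mul_pos k0 l0]
  have m1 : mm1 R B = w * (R + 1 / R) + l * (R - 1 / R) := by
    rw [mm1, b00, b01, b10, b11, hl, hw]; field_simp; ring
  have m2 : mm2 R B = w * (R - 1 / R) + κ * (R + 1 / R) := by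
    rw [mm2, b00, b01, b10, b11, hκ, hw]; field_simp; ring
  have m3 : mm3 R B = w * (R - 1 / R) + l * (R + 1 / R) := by
    rw [mm3, b00, b01, b10, b11, hl, hw]; field_simp; ring
  have m4 : mm4 R B = w * (R + 1 / R) + κ * (R - 1 / R) := by
    rw [mm4, b00, b01, b10, b11, hκ, hw]; field_simp; ring
  have g1 : R + 1 / R < mm1 R B := by rw [m1]; linarith [mul_pos l0 hD, mul_pos (sub_pos.mpr w1) hS]
  have g2 : R - 1 / R < mm2 R B := by rw [m2]; linarith [mul_pos k0 hS, mul_pos (sub_pos.mpr w1) hD]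
  have g3 : R - 1 / R < mm3 R B := by rw [m3]; linarith [mul_pos l0 hS, mul_pos (sub_pos.mpr w1) hD]
  have g4 : R + 1 / R < mm4 R B := by rw [m4]; linarith [mul_pos k0 hD, mul_pos (sub_pos.mpr w1) hS]
  have n1 : 0 < mm1 R B := hS.trans g1
  have n2 : 0 < mm2 R B := hD.trans g2
  have n3 : 0 < mm3 R B := hD.trans g3
  have n4 : 0 < mm4 R B := hS.trans g4
  clear m1 m2 m3 m4 hκ hl hw hdet hdet' h1 hk h2 w1 w0 k0 l0
  rcases le_total 0 τ with ht | ht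
  · obtain ⟨e1, e2, e3, e4⟩ := mm_mul_nonneg R hR B τ ht
    have hp : 0 < (R + 1 / R) * mm2 R B + (R - 1 / R) * mm1 R B := by positivity
    have hFA : FF R (B * PtM R hR τ) =
        -(2 * τ * ((R + 1 / R) * mm2 R B + (R - 1 / R) * mm1 R B)) := by
      rw [FF] at hF ⊢
      rw [e1, e2, e3, e4]; linear_combination hF
    constructor
    · refine ⟨by rw [e1]; exact g1, by rw [e2]; exact g2, ?_, ?_⟩
      · rw [e3]; linarith [mul_nonneg ht n1.le]
      · rw [e4]; linarith [mul_nonneg ht n2.le]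
    · rw [tau_of_nonpos (by rw [hFA, neg_nonpos]; positivity), hFA, e1, e2, neg_neg]
      rw [div_eq_iff (by positivity)]; ring
  · obtain ⟨e1, e2, e3, e4⟩ := mm_mul_nonpos R hR B τ ht
    have hp : 0 < (R + 1 / R) * mm3 R B + (R - 1 / R) * mm4 R B := by positivity
    have hFA : FF R (B * PtM R hR τ) =
        2 * (-τ) * ((R + 1 / R) * mm3 R B + (R - 1 / R) * mm4 R B) := by
      rw [FF] at hF ⊢
      rw [e1, e2, e3, e4]; linear_combination hF
    constructor
    · refine ⟨?_, ?_, by rw [e3]; exact g3, by rw [e4]; exact g4⟩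
      · rw [e1]; linarith [mul_nonneg (neg_nonneg.mpr ht) n3.le]
      · rw [e2]; linarith [mul_nonneg (neg_nonneg.mpr ht) n4.le]
    · have : 0 ≤ -τ := by linarith
      rw [tau_of_nonneg (by rw [hFA]; positivity), hFA, e3, e4, ← neg_div,
        div_eq_iff (by positivity)]
      ring

theorem PtM_cont (R : ℝ) (hR : 1 < R) : Continuous (PtM R hR) := by
  refine continuous_induced_rng.2 (continuous_matrix fun i j => ?_)
  fin_cases i <;> fin_cases j <;> simp [PtM, Function.comp_def] <;> fun_prop

theorem entry_cont (i j : Fin 2) : Continuous fun A : SL2 => A i j :=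
  (continuous_induced_dom (f := fun A : SL2 => (A : Matrix (Fin 2) (Fin 2) ℝ))).matrix_elem i j

theorem mm_cont (R : ℝ) : Continuous (mm1 R) ∧ Continuous (mm2 R) ∧ Continuous (mm3 R) ∧
    Continuous (mm4 R) := by
  have h00 := entry_cont 0 0
  have h01 := entry_cont 0 1
  have h10 := entry_cont 1 0
  have h11 := entry_cont 1 1
  unfold mm1 mm2 mm3 mm4
  refine ⟨?_, ?_, ?_, ?_⟩ <;> fun_prop

theorem UU_open (R : ℝ) : IsOpen (UU R) := by
  obtain ⟨h1, h2, h3, h4⟩ := mm_cont R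
  exact (isOpen_lt continuous_const h1).inter ((isOpen_lt continuous_const h2).inter
    ((isOpen_lt continuous_const h3).inter (isOpen_lt continuous_const h4)))

theorem tau_cont (R : ℝ) (hR : 1 < R) : ContinuousOn (tau R) (UU R) := by
  obtain ⟨c1, c2, c3, c4⟩ := mm_cont R
  obtain ⟨hD, hS, -⟩ := UU_pos hR
  have cF : Continuous (FF R) := by unfold FF; fun_prop
  unfold tau
  refine ContinuousOn.sub (ContinuousOn.div (by fun_prop) (by fun_prop) ?_)
    (ContinuousOn.div (by fun_prop) (by fun_prop) ?_)
  · rintro A ⟨h1, h2, h3, h4⟩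
    have n1 : 0 < mm1 R A := hS.trans h1
    have n2 : 0 < mm2 R A := hD.trans h2
    positivity
  · rintro A ⟨h1, h2, h3, h4⟩
    have n3 : 0 < mm3 R A := hD.trans h3
    have n4 : 0 < mm4 R A := hS.trans h4
    positivity

theorem UU_injOn (R : ℝ) (hR : 1 < R) :
    Set.InjOn (fun A : SL2 => (QuotientGroup.mk A : PSL2)) (UU R) := by
  intro A hA B hB h
  rcases (mk_eq_iff' A B).mp h with h | h
  · exact h.symm
  · exfalso
    obtain ⟨hD, hS, -⟩ := UU_pos hR
    have h1 := hA.1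
    have h2 := hB.1
    rw [h, (mm_neg R A).1] at h2
    linarith

theorem CC0_eq (R : ℝ) (hR : 1 < R) :
    CC0 R = (fun A : SL2 => (QuotientGroup.mk A : PSL2)) '' UU R := by
  ext h
  obtain ⟨A, rfl⟩ := QuotientGroup.mk_surjective h
  rw [mk_mem_CC0 R hR]
  constructor
  · rintro (hA | hA)
    · exact ⟨A, hA, rfl⟩
    · exact ⟨-A, hA, mk_neg' A⟩
  · rintro ⟨B, hB, h⟩
    rcases (mk_eq_iff' B A).mp h with h | h
    · left; rw [h]; exact hB
    · right; rw [h, neg_neg]; exact hB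

theorem assemble (S T C : Set PSL2) (V : Set SL2) (hV : IsOpen V)
    (hC : C = (fun A : SL2 => (QuotientGroup.mk A : PSL2)) '' V)
    (hVi : Set.InjOn (fun A : SL2 => (QuotientGroup.mk A : PSL2)) V)
    (G : SL2 → PSL2 × PSL2) (hGc : ContinuousOn G V)
    (hG : ∀ A ∈ V, G A ∈ S ×ˢ T ∧ (G A).1 * (G A).2 = QuotientGroup.mk A)
    (hrec : ∀ p ∈ S ×ˢ T, ∃ A ∈ V, G A = p) :
    Set.InjOn (fun p : PSL2 × PSL2 => p.1 * p.2) (S ×ˢ T) ∧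
    (fun p : PSL2 × PSL2 => p.1 * p.2) '' (S ×ˢ T) = C ∧
    (∃ e : (S ×ˢ T : Set (PSL2 × PSL2)) ≃ₜ C,
      ∀ x : (S ×ˢ T : Set (PSL2 × PSL2)),
        (e x : PSL2) = (x : PSL2 × PSL2).1 * (x : PSL2 × PSL2).2) := by
  have hmem : ∀ p ∈ S ×ˢ T, p.1 * p.2 ∈ C := by
    intro p hp
    obtain ⟨A, hA, rfl⟩ := hrec p hp
    rw [hC, (hG A hA).2]
    exact ⟨A, hA, rfl⟩
  choose! σ hσV hσ using fun c (hc : c ∈ C) => (by rw [hC] at hc; exact hc :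
    ∃ A ∈ V, (QuotientGroup.mk A : PSL2) = c)
  have hσmk : ∀ A ∈ V, σ (QuotientGroup.mk A) = A := by
    intro A hA
    have hc : (QuotientGroup.mk A : PSL2) ∈ C := by rw [hC]; exact ⟨A, hA, rfl⟩
    exact hVi (hσV _ hc) hA (hσ _ hc)
  have hσc : ContinuousOn (G ∘ σ) C := by
    intro c hc
    refine ContinuousAt.continuousWithinAt ?_
    rw [hC] at hc
    obtain ⟨A, hA, rfl⟩ := hc
    have q : IsOpenQuotientMap (QuotientGroup.mk : SL2 → PSL2) :=
      QuotientGroup.isOpenQuotientMap_mk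
    refine (q.continuousAt_comp_iff).mp ?_
    have : G =ᶠ[𝓝 A] ((G ∘ σ) ∘ (QuotientGroup.mk : SL2 → PSL2)) := by
      filter_upwards [hV.mem_nhds hA] with B hB
      simp only [Function.comp_apply, hσmk B hB]
    exact (hGc.continuousAt (hV.mem_nhds hA)).congr this
  have hinv : ∀ p ∈ S ×ˢ T, G (σ (p.1 * p.2)) = p := by
    intro p hp
    obtain ⟨A, hA, rfl⟩ := hrec p hp
    rw [(hG A hA).2, hσmk A hA]
  refine ⟨?_, ?_, ?_⟩
  · intro p hp p' hp' h
    rw [← hinv p hp, ← hinv p' hp']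
    exact congrArg (fun c => G (σ c)) h
  · apply Set.Subset.antisymm
    · rintro _ ⟨p, hp, rfl⟩
      exact hmem p hp
    · intro c hc
      exact ⟨G (σ c), (hG _ (hσV c hc)).1, ((hG _ (hσV c hc)).2).trans (hσ c hc)⟩
  · refine ⟨{ toFun := fun x => ⟨x.1.1 * x.1.2, hmem _ x.2⟩
              invFun := fun c => ⟨G (σ c.1), (hG _ (hσV c.1 c.2)).1⟩
              left_inv := fun x => Subtype.ext (hinv _ x.2)
              right_inv := fun c => Subtype.ext
                (((hG _ (hσV c.1 c.2)).2).trans (hσ c.1 c.2))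
              continuous_toFun := ?_
              continuous_invFun := ?_ }, fun x => rfl⟩
    · refine Continuous.subtype_mk ?_ _
      exact (continuous_fst.comp continuous_subtype_val).mul
        (continuous_snd.comp continuous_subtype_val)
    · refine Continuous.subtype_mk ?_ _
      exact continuousOn_iff_continuous_domRestrict.mp hσc

/-- transposition -/
def trS (A : SL2) : SL2 := A.transpose

theorem trS_apply (A : SL2) (i j : Fin 2) : trS A i j = A j i := rfl

theorem trS_trS (A : SL2) : trS (trS A) = A := by
  ext i j; rfl

theorem trS_mul (A B : SL2) : trS (A * B) = trS B * trS A := by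
  ext i j
  rw [trS_apply, mul_entries, mul_entries]
  simp only [trS_apply]
  ring

theorem trS_cont : Continuous trS :=
  continuous_induced_rng.2 (continuous_matrix fun i j => entry_cont j i)

theorem trS_UU {R : ℝ} {A : SL2} (h : A ∈ UU R) : trS A ∈ UU R := by
  obtain ⟨h1, h2, h3, h4⟩ := h
  simp only [mm1, mm2, mm3, mm4] at h1 h2 h3 h4
  refine ⟨?_, ?_, ?_, ?_⟩ <;> simp only [mm1, mm2, mm3, mm4, trS_apply] <;> linarith

/-- The factorization, on the level of lifts. -/
def GG (R : ℝ) (hR : 1 < R) (A : SL2) : SL2 × SL2 :=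
  (A * (PtM R hR (tau R A))⁻¹, PtM R hR (tau R A))

theorem GG_cont (R : ℝ) (hR : 1 < R) : ContinuousOn (GG R hR) (UU R) := by
  have h : ContinuousOn (fun A => PtM R hR (tau R A)) (UU R) :=
    (PtM_cont R hR).comp_continuousOn (tau_cont R hR)
  exact (continuousOn_id.mul h.inv).prodMk h

theorem GG_mul (R : ℝ) (hR : 1 < R) (A : SL2) : (GG R hR A).1 * (GG R hR A).2 = A := by
  simp [GG]

theorem GG_rec (R : ℝ) (hR : 1 < R) (B : SL2) (hB : B ∈ QQ R) (τ : ℝ) :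
    GG R hR (B * PtM R hR τ) = (B, PtM R hR τ) := by
  simp [GG, (QQ_UU R hR B hB τ).2]

theorem signed_iff (R : ℝ) (hR : 1 < R) (x : PSL2) (Q : ℝ → PSL2) (N : ℝ → ℝ → PSL2)
    (h : ∀ ε : ℝ, (ε = 1 ∨ ε = -1) → ∀ t : ℝ, 0 ≤ t → N ε t = Q (ε * t)) :
    (∃ ε : ℝ, (ε = 1 ∨ ε = -1) ∧ ∃ t : ℝ, 0 ≤ t ∧ x = N ε t) ↔ ∃ τ, x = Q τ := by
  constructor
  · rintro ⟨ε, hε, t, ht, rfl⟩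
    exact ⟨ε * t, h ε hε t ht⟩
  · rintro ⟨τ, rfl⟩
    rcases le_total 0 τ with h0 | h0
    · exact ⟨1, Or.inl rfl, τ, h0, by rw [h 1 (Or.inl rfl) τ h0, one_mul]⟩
    · refine ⟨-1, Or.inr rfl, -τ, by linarith, ?_⟩
      rw [h (-1) (Or.inr rfl) (-τ) (by linarith)]; simp

theorem abs_sign {ε t : ℝ} (hε : ε = 1 ∨ ε = -1) (ht : 0 ≤ t) : |ε * t| = t := by
  rcases hε with rfl | rfl <;> simp [abs_of_nonneg ht]

theorem S1_iff (R : ℝ) (x : PSL2) :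
    (∃ h ∈ SQell R, x = h⁻¹) ↔ ∃ B ∈ QQ R, (QuotientGroup.mk B : PSL2) = x := by
  constructor
  · rintro ⟨h, ⟨A, α, β, v, rfl, hA, h1, h2⟩, rfl⟩
    have a00 : A 0 0 = α := by rw [hA]; simp
    have a01 : A 0 1 = -v / R := by rw [hA]; simp
    have a10 : A 1 0 = v * R := by rw [hA]; simp
    have a11 : A 1 1 = β := by rw [hA]; simp
    have hβ : β ≠ 0 := by
      rintro rfl
      simp at h1
      exact absurd h1 (not_lt.mpr (abs_nonneg α))
    rcases lt_or_gt_of_ne hβ with hb | hb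
    · refine ⟨-A⁻¹, ⟨-α, -β, -v, ?_, ?_, ?_⟩, by rw [mk_neg']; rfl⟩
      · ext i j
        rw [Matrix.SpecialLinearGroup.coe_neg, Matrix.neg_apply,
          Matrix.SpecialLinearGroup.SL2_inv_expl]
        fin_cases i <;> fin_cases j <;> simp [a00, a01, a10, a11]
      · rw [abs_neg, ← abs_of_neg hb]; exact h1
      · rw [abs_of_neg hb] at h1
        rw [abs_of_pos (by linarith [neg_abs_le α] : 0 < α - β)] at h2
        rw [abs_neg]; linarith
    · refine ⟨A⁻¹, ⟨α, β, v, ?_, ?_, ?_⟩, rfl⟩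
      · rw [Matrix.SpecialLinearGroup.SL2_inv_expl]
        ext i j
        fin_cases i <;> fin_cases j <;> simp [a00, a01, a10, a11]
        ring
      · rwa [← abs_of_pos hb]
      · rw [abs_of_pos hb] at h1
        rw [abs_of_neg (by linarith [le_abs_self α] : α - β < 0)] at h2
        linarith
  · rintro ⟨B, ⟨α, β, v, hB, h1, h2⟩, rfl⟩
    have b00 : B 0 0 = β := by rw [hB]; simp
    have b01 : B 0 1 = v / R := by rw [hB]; simp
    have b10 : B 1 0 = -v * R := by rw [hB]; simp
    have b11 : B 1 1 = α := by rw [hB]; simp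
    refine ⟨QuotientGroup.mk B⁻¹, ⟨B⁻¹, α, β, v, rfl, ?_, ?_, ?_⟩, ?_⟩
    · rw [Matrix.SpecialLinearGroup.SL2_inv_expl]
      ext i j
      fin_cases i <;> fin_cases j <;> simp [b00, b01, b10, b11]
      ring
    · exact h1.trans_le (le_abs_self β)
    · rw [abs_sub_comm]; exact h2.trans_le (le_abs_self _)
    · rw [QuotientGroup.mk_inv, inv_inv]

theorem SQ'_iff (R : ℝ) (x : PSL2) :
    x ∈ SQell' R ↔ ∃ B ∈ QQ R, (QuotientGroup.mk (trS B) : PSL2) = x := by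
  constructor
  · rintro ⟨A, α, β, v, hAx, hA, h1, h2⟩
    have a00 : A 0 0 = α := by rw [hA]; simp
    have a01 : A 0 1 = v * R := by rw [hA]; simp
    have a10 : A 1 0 = -v / R := by rw [hA]; simp
    have a11 : A 1 1 = β := by rw [hA]; simp
    have hx : x = QuotientGroup.mk A⁻¹ := by rw [QuotientGroup.mk_inv, hAx, inv_inv]
    have hβ : β ≠ 0 := by
      rintro rfl
      simp at h1
      exact absurd h1 (not_lt.mpr (abs_nonneg α))
    rcases lt_or_gt_of_ne hβ with hb | hb
    · refine ⟨trS (-A⁻¹), ⟨-α, -β, -v, ?_, ?_, ?_⟩, by rw [trS_trS, mk_neg', hx]⟩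
      · ext i j
        rw [trS_apply, Matrix.SpecialLinearGroup.coe_neg, Matrix.neg_apply,
          Matrix.SpecialLinearGroup.SL2_inv_expl]
        fin_cases i <;> fin_cases j <;> simp [a00, a01, a10, a11]
      · rw [abs_neg, ← abs_of_neg hb]; exact h1
      · rw [abs_of_neg hb] at h1
        rw [abs_of_pos (by linarith [neg_abs_le α] : 0 < α - β)] at h2
        rw [abs_neg]; linarith
    · refine ⟨trS A⁻¹, ⟨α, β, v, ?_, ?_, ?_⟩, by rw [trS_trS, hx]⟩
      · ext i j
        rw [trS_apply, Matrix.SpecialLinearGroup.SL2_inv_expl]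
        fin_cases i <;> fin_cases j <;> simp [a00, a01, a10, a11]
        ring
      · rwa [← abs_of_pos hb]
      · rw [abs_of_pos hb] at h1
        rw [abs_of_neg (by linarith [le_abs_self α] : α - β < 0)] at h2
        linarith
  · rintro ⟨B, ⟨α, β, v, hB, h1, h2⟩, rfl⟩
    have b00 : B 0 0 = β := by rw [hB]; simp
    have b01 : B 0 1 = v / R := by rw [hB]; simp
    have b10 : B 1 0 = -v * R := by rw [hB]; simp
    have b11 : B 1 1 = α := by rw [hB]; simp
    refine ⟨(trS B)⁻¹, α, β, v, rfl, ?_, ?_, ?_⟩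
    · rw [Matrix.SpecialLinearGroup.SL2_inv_expl]
      simp only [trS_apply]
      ext i j
      fin_cases i <;> fin_cases j <;> simp [b00, b01, b10, b11]
      ring
    · exact h1.trans_le (le_abs_self β)
    · rw [abs_sub_comm]; exact h2.trans_le (le_abs_self _)

theorem stmt19 (R : ℝ) (hR : 1 < R)
    (P P' : ℝ → ℝ → PSL2)
    (hP : ∀ ε : ℝ, (ε = 1 ∨ ε = -1) → ∀ t : ℝ,
      ∃ A : SL2, (QuotientGroup.mk A : PSL2) = P ε t ∧
        (A : Matrix (Fin 2) (Fin 2) ℝ) = !![1 - t, -ε * t / R; ε * R * t, 1 + t])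
    (hP' : ∀ ε : ℝ, (ε = 1 ∨ ε = -1) → ∀ t : ℝ,
      ∃ A : SL2, (QuotientGroup.mk A : PSL2) = P' ε t ∧
        (A : Matrix (Fin 2) (Fin 2) ℝ) = !![1 + t, -ε * R * t; ε * t / R, 1 - t])
    (C0 : Set PSL2)
    (hC0 : C0 = {h : PSL2 |
      (∃ c > 0, ∀ x ∈ circ (1 / R), ∀ x' ∈ circ R,
        c ≤ dist x (pslSMul h x') - dist x x') ∧
      pslImg h (circ R) ⊆ {z : ℍ | 1 / R < ‖(z : ℂ)‖} ∧
      circ (1 / R) ∩ pslImg h {z : ℍ | R < ‖(z : ℂ)‖} = ∅})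
    (S1 S2 S3 : Set PSL2)
    (hS1 : S1 = {x | ∃ h ∈ SQell R, x = h⁻¹})
    (hS2 : S2 = {x | ∃ ε : ℝ, (ε = 1 ∨ ε = -1) ∧ ∃ t : ℝ, 0 ≤ t ∧ x = P' ε t})
    (hS3 : S3 = {x | ∃ ε : ℝ, (ε = 1 ∨ ε = -1) ∧ ∃ t : ℝ, 0 ≤ t ∧ x = (P ε t)⁻¹}) :
    Set.InjOn (fun p : PSL2 × PSL2 => p.1 * p.2) (S1 ×ˢ S2) ∧
    (fun p : PSL2 × PSL2 => p.1 * p.2) '' (S1 ×ˢ S2) = C0 ∧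
    (∃ e : (S1 ×ˢ S2 : Set (PSL2 × PSL2)) ≃ₜ C0,
      ∀ x : (S1 ×ˢ S2 : Set (PSL2 × PSL2)),
        (e x : PSL2) = (x : PSL2 × PSL2).1 * (x : PSL2 × PSL2).2) ∧
    Set.InjOn (fun p : PSL2 × PSL2 => p.1 * p.2) (S3 ×ˢ SQell' R) ∧
    (fun p : PSL2 × PSL2 => p.1 * p.2) '' (S3 ×ˢ SQell' R) = C0 ∧
    (∃ e : (S3 ×ˢ SQell' R : Set (PSL2 × PSL2)) ≃ₜ C0,
      ∀ x : (S3 ×ˢ SQell' R : Set (PSL2 × PSL2)),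
        (e x : PSL2) = (x : PSL2 × PSL2).1 * (x : PSL2 × PSL2).2) := by
  have e0 : C0 = CC0 R := hC0
  have mS1 : ∀ x, x ∈ S1 ↔ ∃ B ∈ QQ R, (QuotientGroup.mk B : PSL2) = x := by
    intro x; rw [hS1]; exact S1_iff R x
  have mS2 : ∀ x, x ∈ S2 ↔ ∃ τ, x = QuotientGroup.mk (PtM R hR τ) := by
    intro x; rw [hS2]
    refine signed_iff R hR x (fun τ => QuotientGroup.mk (PtM R hR τ)) P' ?_
    intro ε hε t ht
    obtain ⟨A, hA, hM⟩ := hP' ε hε t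
    rw [← hA]
    congr 1
    ext i j
    rw [hM]
    fin_cases i <;> fin_cases j <;> simp [PtM, abs_sign hε ht]
    ring
  have mS3 : ∀ x, x ∈ S3 ↔ ∃ τ, x = QuotientGroup.mk (trS (PtM R hR τ)) := by
    intro x; rw [hS3]
    refine signed_iff R hR x (fun τ => QuotientGroup.mk (trS (PtM R hR τ)))
      (fun ε t => (P ε t)⁻¹) ?_
    intro ε hε t ht
    obtain ⟨A, hA, hM⟩ := hP ε hε t
    show (P ε t)⁻¹ = _
    rw [← hA, ← QuotientGroup.mk_inv]
    congr 1
    ext i j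
    have a00 : A 0 0 = 1 - t := by rw [hM]; simp
    have a01 : A 0 1 = -ε * t / R := by rw [hM]; simp
    have a10 : A 1 0 = ε * R * t := by rw [hM]; simp
    have a11 : A 1 1 = 1 + t := by rw [hM]; simp
    rw [trS_apply, Matrix.SpecialLinearGroup.SL2_inv_expl]
    fin_cases i <;> fin_cases j <;> simp [PtM, abs_sign hε ht, a00, a01, a10, a11] <;> ring
  have cmk : Continuous (QuotientGroup.mk : SL2 → PSL2) := continuous_quotient_mk'
  have first := assemble S1 S2 C0 (UU R) (UU_open R) (e0.trans (CC0_eq R hR)) (UU_injOn R hR)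
    (fun A => (QuotientGroup.mk (GG R hR A).1, QuotientGroup.mk (GG R hR A).2))
    ((cmk.comp_continuousOn (continuous_fst.comp_continuousOn (GG_cont R hR))).prodMk
      (cmk.comp_continuousOn (continuous_snd.comp_continuousOn (GG_cont R hR))))
    (fun A hA => ⟨⟨(mS1 _).mpr ⟨_, UU_QQ R hR A hA, rfl⟩, (mS2 _).mpr ⟨_, rfl⟩⟩, by
      show (QuotientGroup.mk ((GG R hR A).1 * (GG R hR A).2) : PSL2) = _
      rw [GG_mul]⟩)
    (by
      rintro ⟨x, y⟩ ⟨hx, hy⟩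
      obtain ⟨B, hB, rfl⟩ := (mS1 x).mp hx
      obtain ⟨τ, rfl⟩ := (mS2 y).mp hy
      refine ⟨B * PtM R hR τ, (QQ_UU R hR B hB τ).1, ?_⟩
      simp only [GG_rec R hR B hB τ])
  have hGt : ContinuousOn (fun A => GG R hR (trS A)) (UU R) :=
    (GG_cont R hR).comp trS_cont.continuousOn (fun A hA => trS_UU hA)
  have second := assemble S3 (SQell' R) C0 (UU R) (UU_open R) (e0.trans (CC0_eq R hR))
    (UU_injOn R hR)
    (fun A => (QuotientGroup.mk (trS (GG R hR (trS A)).2),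
      QuotientGroup.mk (trS (GG R hR (trS A)).1)))
    (((cmk.comp trS_cont).comp_continuousOn (continuous_snd.comp_continuousOn hGt)).prodMk
      ((cmk.comp trS_cont).comp_continuousOn (continuous_fst.comp_continuousOn hGt)))
    (fun A hA => ⟨⟨(mS3 _).mpr ⟨_, rfl⟩,
      (SQ'_iff R _).mpr ⟨_, UU_QQ R hR (trS A) (trS_UU hA), rfl⟩⟩, by
      show (QuotientGroup.mk (trS (GG R hR (trS A)).2 * trS (GG R hR (trS A)).1) : PSL2) = _
      rw [← trS_mul, GG_mul, trS_trS]⟩)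
    (by
      rintro ⟨x, y⟩ ⟨hx, hy⟩
      obtain ⟨τ, rfl⟩ := (mS3 x).mp hx
      obtain ⟨B, hB, rfl⟩ := (SQ'_iff R y).mp hy
      refine ⟨trS (B * PtM R hR τ), trS_UU (QQ_UU R hR B hB τ).1, ?_⟩
      simp only [trS_trS, GG_rec R hR B hB τ])
  exact ⟨first.1, first.2.1, first.2.2, second.1, second.2.1, second.2.2⟩

end
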